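/- Let n ≥ 1 and let ν₁, …, νₙ be Borel probability measures on ℝ. Define, for a Borel probability measure μ on ℝⁿ (modeled as Fin n → ℝ), the penalty ρ(μ) := Σ_{i=1}^{n} sup_{f ∈ C_b(ℝ)} ( ∫ f d(μ.map πᵢ) − ∫ f dνᵢ ), with values in the extended reals [0, +∞], where πᵢ is the i-th coordinate projection and the supremum ranges over bounded continuous f : ℝ → ℝ. Then ρ is lower semicontinuous on ProbabilityMeasure ℝⁿ equipped with the topology of weak convergence: for every μ₀ and every sequence (or net) μⱼ → μ₀ weakly, liminf ρ(μⱼ) ≥ ρ(μ₀). (This is Lemma 3.5 of the paper.) -/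

import Mathlib

open MeasureTheory BoundedContinuousFunction

/-- A finite sum of nonnegative `EReal`-valued lower semicontinuous functions is
lower semicontinuous. -/
theorem lowerSemicontinuous_finset_sum_ereal {α ι : Type*} [TopologicalSpace α]
    {g : ι → α → EReal} (hg : ∀ i, LowerSemicontinuous (g i)) (h_nonneg : ∀ i a, 0 ≤ g i a)
    (s : Finset ι) : LowerSemicontinuous fun a => ∑ i ∈ s, g i a := by
  classical
  induction s using Finset.induction_on with
  | empty => simpa using lowerSemicontinuous_const
  | insert i s hi ih =>
    simp only [Finset.sum_insert hi]
    refine (hg i).add' ih fun a => EReal.continuousAt_add (Or.inr ?_) (Or.inl ?_)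
    · exact (EReal.bot_lt_zero.trans_le (Finset.sum_nonneg fun j _ => h_nonneg j a)).ne'
    · exact (EReal.bot_lt_zero.trans_le (h_nonneg i a)).ne'

/-- Integrating a bounded continuous function against the pushforward along a continuous map
is weakly continuous in the measure. -/
theorem continuous_integral_map_boundedContinuousFunction {X Y : Type*}
    [TopologicalSpace X] [MeasurableSpace X] [OpensMeasurableSpace X]
    [TopologicalSpace Y] [MeasurableSpace Y] [BorelSpace Y]
    {φ : X → Y} (hφ : Continuous φ) (f : Y →ᵇ ℝ) :
    Continuous fun μ : ProbabilityMeasure X => ∫ y, f y ∂((μ : Measure X).map φ) :=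
  (ProbabilityMeasure.continuous_integral_boundedContinuousFunction f).comp
    (ProbabilityMeasure.continuous_map hφ)

/-- Lemma 3.5 of the paper: the marginal-matching penalty
`ρ(μ) = Σᵢ sup_{f ∈ C_b(ℝ)} (∫ f d(μ ∘ πᵢ⁻¹) − ∫ f dνᵢ)`
is lower semicontinuous with respect to the topology of weak convergence. -/
theorem penalty_lowerSemicontinuous
    (n : ℕ) (hn : 1 ≤ n) (ν : Fin n → ProbabilityMeasure ℝ) :
    LowerSemicontinuous fun μ : ProbabilityMeasure (Fin n → ℝ) =>
      ∑ i : Fin n, ⨆ f : ℝ →ᵇ ℝ,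
        (((∫ x, f x ∂((μ : Measure (Fin n → ℝ)).map (fun w => w i))) -
          (∫ x, f x ∂(ν i : Measure ℝ)) : ℝ) : EReal) := by
  refine lowerSemicontinuous_finset_sum_ereal (fun i => ?_) (fun i μ => ?_) Finset.univ
  · refine lowerSemicontinuous_iSup fun f => Continuous.lowerSemicontinuous ?_
    have h := continuous_integral_map_boundedContinuousFunction
      (continuous_apply (A := fun _ : Fin n => ℝ) i) f
    exact continuous_coe_real_ereal.comp (h.sub continuous_const)
  · exact le_iSup_of_le 0 (by simp)
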